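/- Let n ≥ 2 and let ℏ : Fin n → ℕ be a constant function. Then for every m ≥ 1, every permutation σ of Fin n, every i ∈ Fin n, and every f ∈ ℏ^{⦃m⦄}(i) with f not the zero function: for every j ∈ Fin n the function f∘σ belongs to ↑ℏ^{[m]}(j). -/

import Mathlib

/-- The indicator function `1_i : Fin n → ℕ` of `{i}`. -/
def oneAt {n : ℕ} (i : Fin n) : Fin n → ℕ := fun j => if j = i then 1 else 0

/-- Pointwise sumset `Σ_{j ∈ Fin n} A j` of a family of sets of functions. -/
def sumset {n : ℕ} (A : Fin n → Set (Fin n → ℕ)) : Set (Fin n → ℕ) :=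
  {x | ∃ a : Fin n → Fin n → ℕ, (∀ j, a j ∈ A j) ∧ x = ∑ j, a j}

/-- The strict lower cone `↓ℏ`. -/
def lowerCone {n : ℕ} (h : Fin n → ℕ) : Set (Fin n → ℕ) :=
  {g | ∀ i, g i < h i}

/-- One step of the generation process: `{x - x(i)·1_i : x ∈ ↓ℏ ∩ Σ_j B j}`. -/
def genStep {n : ℕ} (h : Fin n → ℕ) (B : Fin n → Set (Fin n → ℕ)) (i : Fin n) :
    Set (Fin n → ℕ) :=
  {y | ∃ x ∈ lowerCone h ∩ sumset B, y = x - x i • oneAt i}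

/-- The sets `ℏ^{[m]}(i)`. -/
def bracketSet {n : ℕ} (h : Fin n → ℕ) : ℕ → Fin n → Set (Fin n → ℕ)
  | 0 => fun i => {oneAt i}
  | m + 1 => fun i => genStep h (bracketSet h m) i ∪ bracketSet h m i

/-- The sets `ℏ^{⦃m⦄}(i)`. -/
def braceSet {n : ℕ} (h : Fin n → ℕ) : ℕ → Fin n → Set (Fin n → ℕ)
  | 0 => fun i => {oneAt i}
  | m + 1 => genStep h (bracketSet h m)

/-- The upper set `↑A = {f : ∃ g ∈ A, g ≤ f pointwise}`. -/
def upperSet {n : ℕ} (A : Set (Fin n → ℕ)) : Set (Fin n → ℕ) :=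
  {f | ∃ g ∈ A, ∀ i, g i ≤ f i}

theorem oneAt_comp_perm {n : ℕ} (σ : Equiv.Perm (Fin n)) (i : Fin n) :
    oneAt i ∘ σ = oneAt (σ.symm i) := by
  funext k
  simp [oneAt, Equiv.eq_symm_apply]

theorem genStep_comp_perm {n : ℕ} {h : Fin n → ℕ} (hconst : ∀ i j, h i = h j)
    {B : Fin n → Set (Fin n → ℕ)} (σ : Equiv.Perm (Fin n))
    (hB : ∀ i, ∀ f ∈ B i, f ∘ σ ∈ B (σ.symm i)) {i : Fin n} {f : Fin n → ℕ}
    (hf : f ∈ genStep h B i) : f ∘ σ ∈ genStep h B (σ.symm i) := by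
  obtain ⟨x, ⟨hx, a, ha, rfl⟩, rfl⟩ := hf
  refine ⟨(∑ j, a j) ∘ σ, ⟨fun k => ?_, fun k => a (σ k) ∘ σ, fun k => ?_, ?_⟩, ?_⟩
  · exact (hx (σ k)).trans_eq (hconst _ _)
  · simpa using hB (σ k) _ (ha (σ k))
  · funext k
    simpa using (Equiv.sum_comp σ fun j => a j (σ k)).symm
  · rw [← oneAt_comp_perm]
    funext k
    simp

theorem bracketSet_comp_perm {n : ℕ} {h : Fin n → ℕ} (hconst : ∀ i j, h i = h j)
    (σ : Equiv.Perm (Fin n)) (m : ℕ) :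
    ∀ i, ∀ f ∈ bracketSet h m i, f ∘ σ ∈ bracketSet h m (σ.symm i) := by
  induction m with
  | zero =>
    rintro i f rfl
    exact oneAt_comp_perm σ i
  | succ m ih =>
    rintro i f (hf | hf)
    · exact Or.inl (genStep_comp_perm hconst σ ih hf)
    · exact Or.inr (ih i f hf)

theorem genStep_apply_self {n : ℕ} {h : Fin n → ℕ} {B : Fin n → Set (Fin n → ℕ)}
    {i : Fin n} {f : Fin n → ℕ} (hf : f ∈ genStep h B i) : f i = 0 := by
  obtain ⟨x, -, rfl⟩ := hf
  simp [oneAt]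

theorem oneAt_mem_bracketSet {n : ℕ} (h : Fin n → ℕ) (m : ℕ) (i : Fin n) :
    oneAt i ∈ bracketSet h m i := by
  induction m with
  | zero => exact rfl
  | succ m ih => exact Or.inr ih

theorem comp_swap_of_apply_eq {α β : Type*} [DecidableEq α] {f : α → β} {a b : α}
    (hab : f a = f b) : f ∘ Equiv.swap a b = f := by
  rw [Equiv.comp_swap_eq_update, hab, Function.update_eq_self, ← hab, Function.update_eq_self]

/-- Lemma: for a constant `ℏ`, `m ≥ 1`, a permutation `σ`, and a nonzero
`f ∈ ℏ^{⦃m⦄}(i)`, the function `f ∘ σ` belongs to `↑ℏ^{[m]}(j)` for every `j`. -/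
theorem braceSet_comp_perm_mem_upperSet (n : ℕ) (hn : 2 ≤ n)
    (h : Fin n → ℕ) (hconst : ∀ i j, h i = h j)
    (m : ℕ) (hm : 1 ≤ m) (σ : Equiv.Perm (Fin n)) (i : Fin n) (f : Fin n → ℕ)
    (hf : f ∈ braceSet h m i) (hf0 : f ≠ 0) (j : Fin n) :
    f ∘ σ ∈ upperSet (bracketSet h m j) := by
  obtain ⟨m, rfl⟩ := Nat.exists_eq_add_of_le' hm
  have hg : f ∘ σ ∈ genStep h (bracketSet h m) (σ.symm i) :=
    genStep_comp_perm hconst σ (bracketSet_comp_perm hconst σ m) hf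
  by_cases hj : (f ∘ σ) j = 0
  · refine ⟨f ∘ σ, Or.inl ?_, fun _ => le_rfl⟩
    have hswap := genStep_comp_perm hconst (Equiv.swap (σ.symm i) j)
      (bracketSet_comp_perm hconst _ m) hg
    rwa [comp_swap_of_apply_eq ((genStep_apply_self hg).trans hj.symm), Equiv.symm_swap,
      Equiv.swap_apply_left] at hswap
  · refine ⟨oneAt j, oneAt_mem_bracketSet h _ j, fun k => ?_⟩
    by_cases hk : k = j
    · subst hk
      simpa [oneAt] using Nat.one_le_iff_ne_zero.mpr hj
    · simp [oneAt, hk]
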